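/- arXiv:math/0609571 — 3 statements merged into one kernel-verified Lean document; each statement's English description precedes it below -/
import Mathlib

section
/- For every n ≥ 2, the holomorph Hol(C_{2^n} × C_2) has a normal subgroup N isomorphic to the elementary abelian group (C_2)^4 such that the quotient Hol(C_{2^n} × C_2)/N is isomorphic to Hol(C_2) × Hol(C_{2^{n-1}}). -/
/-- The holomorph of a group `G`: the semidirect product `G ⋊ Aut(G)` with the
natural action of `MulAut G` on `G`. -/
def Hol (G : Type*) [Group G] :=
  SemidirectProduct G (MulAut G) (MonoidHom.id (MulAut G))

instance (G : Type*) [Group G] : Group (Hol G) :=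
  inferInstanceAs (Group (SemidirectProduct G (MulAut G) (MonoidHom.id (MulAut G))))

namespace HolZModTwoPow

open Multiplicative

lemma zmultiplesHom_two_pow (m : ℕ) :
    zmultiplesHom _ ((2 ^ m : ℕ) : ZMod (2 ^ (m + 1))) (2 : ℕ) = 0 := by
  rw [zmultiplesHom_apply, natCast_zsmul, nsmul_eq_mul, ← Nat.cast_mul, ← pow_succ',
    ZMod.natCast_self]

/-- The embedding `ZMod 2 → ZMod (2 ^ (m + 1))`, `s ↦ 2 ^ m * s`. -/
def incl (m : ℕ) : ZMod 2 →+ ZMod (2 ^ (m + 1)) :=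
  ZMod.lift 2 ⟨zmultiplesHom _ ((2 ^ m : ℕ) : ZMod (2 ^ (m + 1))), zmultiplesHom_two_pow m⟩

/-- Reduction `ZMod (2 ^ (m + 1)) → ZMod (2 ^ m)`. -/
def red (m : ℕ) : ZMod (2 ^ (m + 1)) →+* ZMod (2 ^ m) :=
  ZMod.castHom (pow_dvd_pow 2 m.le_succ) _

/-- Reduction `ZMod (2 ^ (m + 1)) → ZMod 2`. -/
def parity (m : ℕ) : ZMod (2 ^ (m + 1)) →+* ZMod 2 :=
  ZMod.castHom (dvd_pow_self 2 m.succ_ne_zero) _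

lemma incl_natCast (m k : ℕ) : incl m k = (2 ^ m * k : ℕ) := by
  have h := ZMod.lift_coe 2 ⟨zmultiplesHom _ ((2 ^ m : ℕ) : ZMod (2 ^ (m + 1))),
    zmultiplesHom_two_pow m⟩ (k : ℤ)
  rw [Int.cast_natCast] at h
  refine h.trans ?_
  simp [mul_comm]

lemma incl_injective (m : ℕ) : Function.Injective (incl m) := by
  rw [injective_iff_map_eq_zero]
  intro s hs
  obtain ⟨k, rfl⟩ := ZMod.natCast_zmod_surjective s
  rw [incl_natCast, ZMod.natCast_eq_zero_iff, pow_succ] at hs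
  exact (ZMod.natCast_eq_zero_iff _ _).2 (Nat.dvd_of_mul_dvd_mul_left (by positivity) hs)

lemma mul_incl (m : ℕ) (x : ZMod (2 ^ (m + 1))) (s : ZMod 2) :
    x * incl m s = incl m (parity m x * s) := by
  obtain ⟨k, rfl⟩ := ZMod.natCast_zmod_surjective s
  obtain ⟨j, rfl⟩ := ZMod.natCast_zmod_surjective x
  rw [map_natCast (parity m), ← Nat.cast_mul, incl_natCast, incl_natCast, ← Nat.cast_mul]
  congr 1
  ring

lemma red_eq_zero_iff {m : ℕ} {x : ZMod (2 ^ (m + 1))} : red m x = 0 ↔ ∃ s, incl m s = x := by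
  constructor
  · obtain ⟨k, rfl⟩ := ZMod.natCast_zmod_surjective x
    rw [map_natCast, ZMod.natCast_eq_zero_iff]
    rintro ⟨j, rfl⟩
    exact ⟨j, incl_natCast m j⟩
  · rintro ⟨s, rfl⟩
    obtain ⟨k, rfl⟩ := ZMod.natCast_zmod_surjective s
    rw [incl_natCast, map_natCast, ZMod.natCast_eq_zero_iff]
    exact dvd_mul_right _ _

@[simp] lemma red_incl (m : ℕ) (s : ZMod 2) : red m (incl m s) = 0 :=
  red_eq_zero_iff.2 ⟨s, rfl⟩

lemma exists_incl_of_add_self {m : ℕ} {x : ZMod (2 ^ (m + 1))} (hx : x + x = 0) :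
    ∃ s, incl m s = x := by
  obtain ⟨k, rfl⟩ := ZMod.natCast_zmod_surjective x
  rw [← Nat.cast_add, ← two_mul, ZMod.natCast_eq_zero_iff, pow_succ'] at hx
  rw [← red_eq_zero_iff, map_natCast, ZMod.natCast_eq_zero_iff]
  exact Nat.dvd_of_mul_dvd_mul_left two_pos hx

lemma parity_incl {m : ℕ} (hm : m ≠ 0) (s : ZMod 2) : parity m (incl m s) = 0 := by
  obtain ⟨k, rfl⟩ := ZMod.natCast_zmod_surjective s
  rw [incl_natCast, map_natCast, ZMod.natCast_eq_zero_iff]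
  exact (dvd_pow_self 2 hm).mul_right k

lemma eq_zero_or_one (s : ZMod 2) : s = 0 ∨ s = 1 := by
  revert s; decide

lemma add_self (s : ZMod 2) : s + s = 0 := CharTwo.add_self_eq_zero s

lemma incl_add_self (m : ℕ) (s : ZMod 2) : incl m s + incl m s = 0 := by
  rw [← map_add, add_self, map_zero]

lemma isUnit_of_parity {m : ℕ} {x : ZMod (2 ^ (m + 1))} (hx : parity m x = 1) : IsUnit x := by
  obtain ⟨k, rfl⟩ := ZMod.natCast_zmod_surjective x
  rw [map_natCast] at hx
  rw [ZMod.isUnit_iff_coprime]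
  refine Nat.Coprime.pow_right _ ?_
  rw [← ZMod.isUnit_iff_coprime, hx]
  exact isUnit_one

lemma exists_unit_red {m : ℕ} (hm : m ≠ 0) (u : (ZMod (2 ^ m))ˣ) :
    ∃ v : (ZMod (2 ^ (m + 1)))ˣ, red m v = u := by
  obtain ⟨k, hk⟩ := ZMod.natCast_zmod_surjective (u : ZMod (2 ^ m))
  have h : IsUnit ((k : ℕ) : ZMod (2 ^ (m + 1))) := by
    have h := u.isUnit
    rw [← hk, ZMod.isUnit_iff_coprime, Nat.coprime_pow_right_iff (Nat.pos_of_ne_zero hm)] at h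
    exact (ZMod.isUnit_iff_coprime _ _).2 (h.pow_right _)
  exact ⟨h.unit, by rw [IsUnit.unit_spec, map_natCast, hk]⟩

/-- The group `C_{2^(m+1)} × C_2`, written additively. -/
abbrev A (m : ℕ) := ZMod (2 ^ (m + 1)) × ZMod 2

section Aut

variable {m : ℕ}

/-- A multiplicative automorphism of `Multiplicative (A m)` acting on `A m`. -/
def act (e : MulAut (Multiplicative (A m))) : A m →+ A m :=
  AddMonoidHom.toMultiplicative.symm e.toMonoidHom

lemma act_mul (e f : MulAut (Multiplicative (A m))) (v : A m) :
    act (e * f) v = act e (act f v) := rfl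

lemma act_injective (e : MulAut (Multiplicative (A m))) : Function.Injective (act e) :=
  e.injective

lemma exists_shear (e : MulAut (Multiplicative (A m))) : ∃ s, incl m s = (act e (0, 1)).1 := by
  apply exists_incl_of_add_self
  rw [← Prod.fst_add, ← map_add, Prod.mk_add_mk, add_self, add_zero]
  exact congrArg Prod.fst (map_zero (act e))

/-- The component `C_2 → C_{2^(m+1)}` of an automorphism. -/
noncomputable def shear (e : MulAut (Multiplicative (A m))) : ZMod 2 := (exists_shear e).choose

lemma incl_shear (e : MulAut (Multiplicative (A m))) : incl m (shear e) = (act e (0, 1)).1 :=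
  (exists_shear e).choose_spec

lemma act_fst_zero (e : MulAut (Multiplicative (A m))) (x : ZMod (2 ^ (m + 1))) :
    act e (x, 0) = ((act e (1, 0)).1 * x, parity m x * (act e (1, 0)).2) := by
  obtain ⟨k, rfl⟩ := ZMod.natCast_zmod_surjective x
  have : (((k : ZMod (2 ^ (m + 1))), 0) : A m) = k • (1, 0) := by simp
  rw [this, map_nsmul, map_natCast]
  ext <;> simp [mul_comm]

lemma act_incl (hm : m ≠ 0) (e : MulAut (Multiplicative (A m))) (s : ZMod 2) :
    act e (incl m s, 0) = (incl m (parity m (act e (1, 0)).1 * s), 0) := by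
  rw [act_fst_zero, mul_incl, parity_incl hm, zero_mul]

lemma parity_act (hm : m ≠ 0) (e : MulAut (Multiplicative (A m))) :
    parity m (act e (1, 0)).1 = 1 := by
  refine (eq_zero_or_one _).resolve_left fun h => ?_
  have h1 := act_incl hm e 1
  rw [h, zero_mul, map_zero] at h1
  have h2 := congrArg Prod.fst (act_injective e (h1.trans (map_zero (act e)).symm))
  exact one_ne_zero (incl_injective m (h2.trans (map_zero _).symm))

lemma act_snd (hm : m ≠ 0) (e : MulAut (Multiplicative (A m))) : (act e (0, 1)).2 = 1 := by
  refine (eq_zero_or_one _).resolve_left fun h => ?_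
  have h1 := act_incl hm e (shear e)
  rw [parity_act hm, one_mul, incl_shear, ← h] at h1
  have h2 : (act e (0, 1)).2 = 1 := congrArg Prod.snd (act_injective e h1)
  exact zero_ne_one (h.symm.trans h2)

lemma act_apply (hm : m ≠ 0) (e : MulAut (Multiplicative (A m))) (x : ZMod (2 ^ (m + 1)))
    (y : ZMod 2) : act e (x, y) =
      ((act e (1, 0)).1 * x + incl m (shear e * y), parity m x * (act e (1, 0)).2 + y) := by
  have h : ((x, y) : A m) = (x, 0) + (0, y) := by simp
  rw [h, map_add, act_fst_zero]
  have h0 : act e (0, 0) = 0 := map_zero _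
  rcases eq_zero_or_one y with rfl | rfl
  · ext <;> simp [h0]
  · ext <;> simp [incl_shear, act_snd hm]

lemma shear_mul (hm : m ≠ 0) (e f : MulAut (Multiplicative (A m))) :
    shear (e * f) = shear e + shear f := by
  apply incl_injective m
  rw [incl_shear, act_mul, ← Prod.mk.eta (p := act f (0, 1)), act_apply hm e, act_snd hm,
    ← incl_shear f, mul_incl, parity_act hm, one_mul, mul_one, map_add]
  exact add_comm _ _

/-- The `C_2`-component of an automorphism, as a homomorphism. -/
noncomputable def shearHom (hm : m ≠ 0) :
    MulAut (Multiplicative (A m)) →* Multiplicative (ZMod 2) :=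
  MonoidHom.mk' (fun e => ofAdd (shear e)) fun e f => congrArg ofAdd (shear_mul hm e f)

/-- The multiplier of an automorphism modulo `2 ^ m`, as a homomorphism. -/
def mult (hm : m ≠ 0) : MulAut (Multiplicative (A m)) →* ZMod (2 ^ m) where
  toFun e := red m (act e (1, 0)).1
  map_one' := map_one (red m)
  map_mul' e f := by
    rw [act_mul, ← Prod.mk.eta (p := act f (1, 0)), act_apply hm e]
    simp

/-- The automorphism of a cyclic group given by a unit. -/
def unitAut (k : ℕ) : (ZMod k)ˣ →* MulAut (Multiplicative (ZMod k)) :=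
  (MulAutMultiplicative (ZMod k)).symm.toMonoidHom.comp AddAut.mulLeft

lemma unitAut_apply (k : ℕ) (u : (ZMod k)ˣ) (x : ZMod k) :
    unitAut k u (ofAdd x) = ofAdd (u * x) := rfl

lemma unitAut_surjective (k : ℕ) [NeZero k] : Function.Surjective (unitAut k) := by
  have key : ∀ (e : MulAut (Multiplicative (ZMod k))) (x : ZMod k),
      toAdd (e (ofAdd x)) = toAdd (e (ofAdd 1)) * x := by
    intro e x
    obtain ⟨j, rfl⟩ := ZMod.natCast_zmod_surjective x
    have : (ofAdd (j : ZMod k)) = ofAdd (1 : ZMod k) ^ j := by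
      rw [← ofAdd_nsmul, nsmul_one]
    rw [this, map_pow, toAdd_pow, nsmul_eq_mul, mul_comm]
  intro e
  have h : toAdd (e (ofAdd 1)) * toAdd (e⁻¹ (ofAdd 1)) = 1 := by
    rw [← key, ofAdd_toAdd, MulAut.apply_inv_self, toAdd_ofAdd]
  refine ⟨Units.mkOfMulEqOne _ _ h, MulEquiv.ext fun x => ?_⟩
  exact congrArg ofAdd (key e (toAdd x)).symm

lemma unitAut_injective (k : ℕ) : Function.Injective (unitAut k) := by
  intro u v h
  have := congrArg toAdd (DFunLike.congr_fun h (ofAdd 1))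
  rw [unitAut_apply, unitAut_apply] at this
  exact Units.ext (by simpa using this)

/-- The action induced on `C_{2^m}`. -/
def redAut (hm : m ≠ 0) : MulAut (Multiplicative (A m)) →* MulAut (Multiplicative (ZMod (2 ^ m))) :=
  (unitAut (2 ^ m)).comp (mult hm).toHomUnits

lemma redAut_apply (hm : m ≠ 0) (e : MulAut (Multiplicative (A m))) (x : ZMod (2 ^ m)) :
    redAut hm e (ofAdd x) = ofAdd (red m (act e (1, 0)).1 * x) := rfl

lemma redAut_eq_one_iff (hm : m ≠ 0) (e : MulAut (Multiplicative (A m))) :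
    redAut hm e = 1 ↔ red m (act e (1, 0)).1 = 1 := by
  rw [redAut, MonoidHom.comp_apply, map_eq_one_iff _ (unitAut_injective _), Units.ext_iff]
  rfl

/-- An automorphism from an additive endomorphism with an explicit inverse. -/
def autOf (f g : A m →+ A m) (hfg : ∀ v, f (g v) = v) (hgf : ∀ v, g (f v) = v) :
    MulAut (Multiplicative (A m)) :=
  AddEquiv.toMultiplicative { f with invFun := g, left_inv := hgf, right_inv := hfg }

lemma act_autOf (f g : A m →+ A m) (hfg : ∀ v, f (g v) = v) (hgf : ∀ v, g (f v) = v) (v : A m) :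
    act (autOf f g hfg hgf) v = f v := rfl

/-- The map `(x, y) ↦ (u x + 2 ^ m b y, y)`. -/
def upperMap (u : ZMod (2 ^ (m + 1))) (b : ZMod 2) : A m →+ A m :=
  AddMonoidHom.mk' (fun v => (u * v.1 + incl m (b * v.2), v.2)) fun v w => by
    ext
    · simp only [Prod.fst_add, Prod.snd_add, mul_add, map_add]; ring
    · rfl

lemma exists_upper (u : (ZMod (2 ^ (m + 1)))ˣ) (b : ZMod 2) :
    ∃ e : MulAut (Multiplicative (A m)), (act e (1, 0)).1 = u ∧ shear e = b := by
  have hu : parity m u = 1 := (eq_zero_or_one _).resolve_left (u.isUnit.map (parity m)).ne_zero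
  have hu' : parity m ↑u⁻¹ = 1 :=
    (eq_zero_or_one _).resolve_left (u⁻¹.isUnit.map (parity m)).ne_zero
  refine ⟨autOf (upperMap u b) (upperMap ↑u⁻¹ b) ?_ ?_, ?_, ?_⟩
  · rintro ⟨x, y⟩
    ext
    · simp [upperMap, mul_add, mul_incl, hu, add_assoc, incl_add_self]
    · rfl
  · rintro ⟨x, y⟩
    ext
    · simp [upperMap, mul_add, mul_incl, hu', add_assoc, incl_add_self]
    · rfl
  · simp [act_autOf, upperMap]
  · apply incl_injective m
    rw [incl_shear]
    simp [act_autOf, upperMap]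

/-- The map `(x, y) ↦ ((1 + 2 ^ m t) x, c x + y)`. -/
def lowerMap (t c : ZMod 2) : A m →+ A m :=
  AddMonoidHom.mk' (fun v => (v.1 + incl m (t * parity m v.1), c * parity m v.1 + v.2))
    fun v w => by
      ext
      · simp only [Prod.fst_add, map_add, mul_add]; ring
      · simp only [Prod.fst_add, Prod.snd_add, map_add, mul_add]; ring

lemma lowerMap_apply (t c : ZMod 2) (x : ZMod (2 ^ (m + 1))) (y : ZMod 2) :
    lowerMap t c (x, y) = (x + incl m (t * parity m x), c * parity m x + y) := rfl

lemma lowerMap_comp (hm : m ≠ 0) (t c t' c' : ZMod 2) (v : A m) :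
    lowerMap t c (lowerMap t' c' v) = lowerMap (t + t') (c + c') v := by
  obtain ⟨x, y⟩ := v
  simp only [lowerMap_apply, map_add, parity_incl hm, add_zero, add_mul]
  ext
  · simp only; ring
  · simp only; ring

lemma lowerMap_zero (v : A m) : lowerMap 0 0 v = v := by
  obtain ⟨x, y⟩ := v
  simp [lowerMap_apply]

/-- `lowerMap` as an automorphism. -/
def lower (hm : m ≠ 0) (t c : ZMod 2) : MulAut (Multiplicative (A m)) :=
  autOf (lowerMap t c) (lowerMap t c)
    (fun v => by rw [lowerMap_comp hm, add_self, add_self, lowerMap_zero])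
    (fun v => by rw [lowerMap_comp hm, add_self, add_self, lowerMap_zero])

lemma act_lower (hm : m ≠ 0) (t c : ZMod 2) (v : A m) : act (lower hm t c) v = lowerMap t c v :=
  rfl

lemma ext_act {e f : MulAut (Multiplicative (A m))} (h : ∀ v, act e v = act f v) : e = f :=
  MulEquiv.ext fun x => congrArg ofAdd (h (toAdd x))

lemma lower_mul (hm : m ≠ 0) (t c t' c' : ZMod 2) :
    lower hm t c * lower hm t' c' = lower hm (t + t') (c + c') :=
  ext_act fun v => lowerMap_comp hm t c t' c' v

lemma shear_lower (hm : m ≠ 0) (t c : ZMod 2) : shear (lower hm t c) = 0 := by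
  apply incl_injective m
  rw [incl_shear, act_lower, lowerMap_apply]
  simp

end Aut

section Holomorph

variable {m : ℕ}

/-- The holomorph as a semidirect product. -/
def holEquiv (G : Type*) [Group G] :
    Hol G ≃* SemidirectProduct G (MulAut G) (MonoidHom.id (MulAut G)) where
  toFun z := z
  invFun z := z
  left_inv _ := rfl
  right_inv _ := rfl
  map_mul' _ _ := rfl

/-- The induced homomorphism on holomorphs `Hol(C_{2^(m+1)} × C_2) → Hol(C_{2^m})`. -/
def redHol (hm : m ≠ 0) : Hol (Multiplicative (A m)) →* Hol (Multiplicative (ZMod (2 ^ m))) :=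
  (holEquiv _).symm.toMonoidHom.comp <| MonoidHom.comp (SemidirectProduct.map
    (AddMonoidHom.toMultiplicative ((red m).toAddMonoidHom.comp
      (AddMonoidHom.fst (ZMod (2 ^ (m + 1))) (ZMod 2))))
    (redAut hm) fun e => by
      refine MonoidHom.ext fun v => ?_
      change ofAdd (red m (act e ((toAdd v : A m).1, (toAdd v : A m).2)).1) =
        redAut hm e (ofAdd (red m (toAdd v : A m).1))
      rw [redAut_apply, act_apply hm]
      simp) (holEquiv _).toMonoidHom

/-- The homomorphism `Hol(C_{2^(m+1)} × C_2) → Hol(C_2)` given by `shear`. -/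
noncomputable def shearHol (hm : m ≠ 0) :
    Hol (Multiplicative (A m)) →* Hol (Multiplicative (ZMod 2)) :=
  (holEquiv _).symm.toMonoidHom.comp <| SemidirectProduct.inl.comp <|
    (shearHom hm).comp <| SemidirectProduct.rightHom.comp (holEquiv _).toMonoidHom

/-- The quotient map. -/
noncomputable def quot (hm : m ≠ 0) : Hol (Multiplicative (A m)) →*
    Hol (Multiplicative (ZMod 2)) × Hol (Multiplicative (ZMod (2 ^ m))) :=
  (shearHol hm).prod (redHol hm)

lemma mulAut_two (e : MulAut (Multiplicative (ZMod 2))) : e = 1 := by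
  obtain ⟨u, rfl⟩ := unitAut_surjective 2 e
  rw [Subsingleton.elim u 1, map_one]

lemma red_surjective (m : ℕ) : Function.Surjective (red m) := ZMod.ringHom_surjective _

lemma quot_surjective (hm : m ≠ 0) : Function.Surjective (quot hm) := by
  rintro ⟨⟨b, e⟩, ⟨x, f⟩⟩
  obtain rfl := mulAut_two e
  obtain ⟨u, rfl⟩ := unitAut_surjective (2 ^ m) f
  obtain ⟨v, hv⟩ := exists_unit_red hm u
  obtain ⟨g, hg, hb⟩ := exists_upper v (toAdd b)
  obtain ⟨x', hx⟩ := red_surjective m (toAdd x)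
  refine ⟨(⟨ofAdd (x', 0), g⟩ : SemidirectProduct _ _ _), Prod.ext ?_ ?_⟩
  · exact SemidirectProduct.ext (congrArg ofAdd hb) rfl
  · refine SemidirectProduct.ext (congrArg ofAdd hx) ?_
    refine congrArg (unitAut (2 ^ m)) (Units.ext ?_)
    exact (congrArg (red m) hg).trans hv

lemma quot_eq_one_iff (hm : m ≠ 0) (v : Multiplicative (A m)) (e : MulAut (Multiplicative (A m))) :
    quot hm (⟨v, e⟩ : SemidirectProduct _ _ _) = 1 ↔
      shear e = 0 ∧ red m (toAdd v).1 = 0 ∧ red m (act e (1, 0)).1 = 1 := by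
  rw [← redAut_eq_one_iff hm]
  constructor
  · intro h
    have h1 := congrArg Prod.fst h
    have h2 := congrArg Prod.snd h
    exact ⟨congrArg SemidirectProduct.left h1, congrArg SemidirectProduct.left h2,
      congrArg SemidirectProduct.right h2⟩
  · rintro ⟨h1, h2, h3⟩
    exact Prod.ext (SemidirectProduct.ext h1 rfl) (SemidirectProduct.ext h2 h3)

/-- The elementary abelian subgroup of order 16, as an embedding. -/
def elemAbelian (hm : m ≠ 0) : Multiplicative (Fin 4 → ZMod 2) →* Hol (Multiplicative (A m)) :=
  MonoidHom.mk' (fun w => (⟨ofAdd (incl m (toAdd w 0), toAdd w 1),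
    lower hm (toAdd w 2) (toAdd w 3)⟩ : SemidirectProduct _ _ _)) fun w z => by
      refine SemidirectProduct.ext ?_
        (lower_mul hm (toAdd w 2) (toAdd w 3) (toAdd z 2) (toAdd z 3)).symm
      change ofAdd _ = ofAdd ((incl m (toAdd w 0), toAdd w 1) +
        lowerMap (toAdd w 2) (toAdd w 3) (incl m (toAdd z 0), toAdd z 1))
      rw [lowerMap_apply, parity_incl hm]
      simp

lemma elemAbelian_injective (hm : m ≠ 0) : Function.Injective (elemAbelian hm) := by
  intro w z h
  have h1 := congrArg SemidirectProduct.left h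
  have h2 := congrArg (fun s => act (SemidirectProduct.right s) (1, 0)) h
  change lowerMap _ _ _ = lowerMap _ _ _ at h2
  rw [lowerMap_apply, lowerMap_apply] at h2
  have h10 := incl_injective m (congrArg (fun v => (toAdd v).1) h1)
  have h11 : toAdd w 1 = toAdd z 1 := congrArg (fun v => (toAdd v).2) h1
  simp only [map_one, mul_one, add_zero, Prod.mk.injEq, add_right_inj] at h2
  have h20 := incl_injective m h2.1
  apply toAdd.injective
  funext i
  fin_cases i
  exacts [h10, h11, h20, h2.2]

lemma range_elemAbelian (hm : m ≠ 0) : (elemAbelian hm).range = (quot hm).ker := by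
  ext ⟨v, e⟩
  refine Iff.trans ?_ (MonoidHom.mem_ker.trans (quot_eq_one_iff hm v e)).symm
  constructor
  · rintro ⟨w, hw⟩
    have h1 := congrArg SemidirectProduct.left hw
    have h2 := congrArg SemidirectProduct.right hw
    change ofAdd _ = v at h1
    change lower hm _ _ = e at h2
    subst h1 h2
    refine ⟨shear_lower hm _ _, red_incl m _, ?_⟩
    rw [act_lower, lowerMap_apply]
    simp
  · rintro ⟨hb, hx, ha⟩
    obtain ⟨s, hs⟩ := red_eq_zero_iff.1 hx
    obtain ⟨t, ht⟩ := red_eq_zero_iff.1 (show red m ((act e (1, 0)).1 - 1) = 0 by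
      rw [map_sub, map_one, ha, sub_self])
    refine ⟨ofAdd ![s, (toAdd v).2, t, (act e (1, 0)).2], SemidirectProduct.ext ?_ ?_⟩
    · exact congrArg ofAdd (Prod.ext hs rfl)
    · refine ext_act fun ⟨x, y⟩ => ?_
      change lowerMap t (act e (1, 0)).2 (x, y) = _
      rw [act_apply hm e x y, hb, lowerMap_apply, mul_comm t, ← mul_incl, ht, zero_mul, map_zero]
      ext
      · simp only; ring
      · simp only; ring

end Holomorph

end HolZModTwoPow

/-- For `n ≥ 2`, the holomorph `Hol(C_{2^n} × C_2)` has a normal subgroup `N` isomorphic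
to the elementary abelian group `(C_2)^4` such that the quotient is isomorphic to
`Hol(C_2) × Hol(C_{2^(n-1)})`. -/
theorem hol_zmod_two_pow_mul_two_structure (n : ℕ) (hn : 2 ≤ n) :
    ∃ (N : Subgroup (Hol (Multiplicative (ZMod (2 ^ n) × ZMod 2)))) (hN : N.Normal),
      Nonempty (N ≃* Multiplicative (Fin 4 → ZMod 2)) ∧
      Nonempty (letI := hN;
        (Hol (Multiplicative (ZMod (2 ^ n) × ZMod 2)) ⧸ N) ≃*
          Hol (Multiplicative (ZMod 2)) × Hol (Multiplicative (ZMod (2 ^ (n - 1))))) := by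
  obtain ⟨m, rfl⟩ : ∃ m, n = m + 1 := ⟨n - 1, by lia⟩
  have hm : m ≠ 0 := by lia
  rw [Nat.add_sub_cancel]
  refine ⟨(HolZModTwoPow.quot hm).ker, inferInstance, ⟨?_⟩, ⟨?_⟩⟩
  · exact ((MonoidHom.ofInjective (HolZModTwoPow.elemAbelian_injective hm)).trans
      (MulEquiv.subgroupCongr (HolZModTwoPow.range_elemAbelian hm))).symm
  · exact QuotientGroup.quotientKerEquivOfSurjective _ (HolZModTwoPow.quot_surjective hm)
end

section
/- For every m ≥ 2 and n ≥ 1, the holomorph Hol(C_{2^m} × (C_2)^n) has a normal subgroup N isomorphic to the elementary abelian group (C_2)^{2(n+1)} such that the quotient Hol(C_{2^m} × (C_2)^n)/N is isomorphic to Hol((C_2)^n) × Hol(C_{2^{m-1}}). -/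
/-- The affine transformation `x ↦ b + e x` as an element of the holomorph. -/
def Hol.affine {B : Type*} [AddCommGroup B] (b : B) (e : B ≃+ B) : Hol (Multiplicative B) :=
  (⟨Multiplicative.ofAdd b, AddEquiv.toMultiplicative e⟩ :
    SemidirectProduct (Multiplicative B) (MulAut (Multiplicative B)) (MonoidHom.id _))

namespace Hol

variable {A B G : Type*} [AddCommGroup A] [AddCommGroup B] [Group G]

lemma affine_mul (b b' : B) (e e' : B ≃+ B) :
    affine b e * affine b' e' = affine (b + e b') (e'.trans e) := rfl

lemma affine_zero_refl : affine (0 : B) (AddEquiv.refl B) = 1 := rfl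

lemma exists_affine (t : Hol (Multiplicative B)) : ∃ b e, t = affine b e :=
  ⟨Multiplicative.toAdd t.1, AddEquiv.toMultiplicative.symm t.2, rfl⟩

lemma affine_inj {b b' : B} {e e' : B ≃+ B} :
    affine b e = affine b' e' ↔ b = b' ∧ ∀ x, e x = e' x := by
  constructor
  · intro h
    refine ⟨congrArg (fun t : Hol (Multiplicative B) ↦ Multiplicative.toAdd t.1) h, fun x ↦ ?_⟩
    exact congrArg (fun t : Hol (Multiplicative B) ↦
      Multiplicative.toAdd (t.2 (Multiplicative.ofAdd x))) h
  · rintro ⟨rfl, h⟩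
    rw [AddEquiv.ext h]

/-- A homomorphism out of a holomorph, from a multiplicative function of affine maps. -/
def lift (F : A → (A ≃+ A) → G)
    (hF : ∀ a e a' e', F (a + e a') (e'.trans e) = F a e * F a' e') :
    Hol (Multiplicative A) →* G :=
  MonoidHom.mk' (fun t ↦ F (Multiplicative.toAdd t.1) (AddEquiv.toMultiplicative.symm t.2))
    fun s t ↦ hF (Multiplicative.toAdd s.1) (AddEquiv.toMultiplicative.symm s.2)
      (Multiplicative.toAdd t.1) (AddEquiv.toMultiplicative.symm t.2)

lemma lift_affine (F : A → (A ≃+ A) → G)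
    (hF : ∀ a e a' e', F (a + e a') (e'.trans e) = F a e * F a' e') (a : A) (e : A ≃+ A) :
    lift F hF (affine a e) = F a e := rfl

/-- Isomorphic groups have isomorphic holomorphs. -/
def congr (f : A ≃+ B) : Hol (Multiplicative A) ≃* Hol (Multiplicative B) :=
  SemidirectProduct.congr (AddEquiv.toMultiplicative f)
    (MulAut.congr (AddEquiv.toMultiplicative f)) fun e ↦ by ext x; simp

end Hol

namespace TwoPow

variable {k : ℕ}

/-- Reduction modulo `2 ^ (k + 1)`. -/
def red (k : ℕ) : ZMod (2 ^ (k + 2)) →+* ZMod (2 ^ (k + 1)) :=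
  ZMod.castHom (pow_dvd_pow 2 (Nat.le_succ _)) _

/-- Reduction modulo `2`. -/
def parity (k : ℕ) : ZMod (2 ^ (k + 2)) →+* ZMod 2 :=
  ZMod.castHom (dvd_pow_self 2 (Nat.succ_ne_zero _)) _

/-- The embedding of `C_2` as the subgroup of order two. -/
def incl (k : ℕ) : ZMod 2 →+ ZMod (2 ^ (k + 2)) :=
  ZMod.lift 2 ⟨zmultiplesHom _ (2 ^ (k + 1)), by
    have : ((2 ^ (k + 2) : ℕ) : ZMod (2 ^ (k + 2))) = 0 := ZMod.natCast_self _
    push_cast at this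
    simp only [zmultiplesHom_apply, natCast_zsmul, nsmul_eq_mul]
    linear_combination this⟩

lemma incl_natCast (c : ℕ) : incl k c = c * 2 ^ (k + 1) := by
  have := ZMod.lift_coe 2 (A := ZMod (2 ^ (k + 2))) (x := (c : ℤ))
  simp only [Int.cast_natCast] at this
  simp [incl, this]

lemma red_surjective : Function.Surjective (red k) := ZMod.castHom_surjective _

lemma exists_incl_of_red_eq_zero {y : ZMod (2 ^ (k + 2))} (h : red k y = 0) :
    ∃ s, incl k s = y := by
  obtain ⟨a, rfl⟩ := ZMod.natCast_zmod_surjective y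
  rw [map_natCast, ZMod.natCast_eq_zero_iff] at h
  obtain ⟨c, rfl⟩ := h
  exact ⟨c, by rw [incl_natCast]; push_cast; ring⟩

lemma red_eq_zero_of_two_mul {y : ZMod (2 ^ (k + 2))} (h : 2 * y = 0) : red k y = 0 := by
  obtain ⟨a, rfl⟩ := ZMod.natCast_zmod_surjective y
  have h' : ((2 * a : ℕ) : ZMod (2 ^ (k + 2))) = 0 := by push_cast; exact h
  rw [ZMod.natCast_eq_zero_iff, pow_succ', Nat.mul_dvd_mul_iff_left two_pos] at h'
  rwa [map_natCast, ZMod.natCast_eq_zero_iff]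

lemma red_incl (s : ZMod 2) : red k (incl k s) = 0 := by
  obtain ⟨c, rfl⟩ := ZMod.natCast_zmod_surjective s
  have : ((2 ^ (k + 1) : ℕ) : ZMod (2 ^ (k + 1))) = 0 := ZMod.natCast_self _
  push_cast at this
  rw [incl_natCast, map_mul, map_pow, map_ofNat, this, mul_zero]

lemma parity_eq_cast_red (y : ZMod (2 ^ (k + 2))) :
    parity k y = ZMod.castHom (dvd_pow_self 2 (Nat.succ_ne_zero k)) (ZMod 2) (red k y) := by
  obtain ⟨a, rfl⟩ := ZMod.natCast_zmod_surjective y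
  simp

lemma parity_incl (s : ZMod 2) : parity k (incl k s) = 0 := by
  rw [parity_eq_cast_red, red_incl, map_zero]

lemma incl_injective : Function.Injective (incl k) := by
  rw [injective_iff_map_eq_zero]
  intro s h
  obtain ⟨c, rfl⟩ := ZMod.natCast_zmod_surjective s
  rw [incl_natCast] at h
  have h' : ((2 ^ (k + 1) * c : ℕ) : ZMod (2 ^ (k + 2))) = 0 := by
    push_cast; rw [mul_comm]; exact h
  rw [ZMod.natCast_eq_zero_iff, pow_succ, Nat.mul_dvd_mul_iff_left (by positivity)] at h'
  rwa [ZMod.natCast_eq_zero_iff]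

lemma mul_eq_zero_of_red_of_parity {y b : ZMod (2 ^ (k + 2))} (hy : red k y = 0)
    (hb : parity k b = 0) : y * b = 0 := by
  obtain ⟨s, rfl⟩ := exists_incl_of_red_eq_zero hy
  obtain ⟨c, rfl⟩ := ZMod.natCast_zmod_surjective s
  obtain ⟨a, rfl⟩ := ZMod.natCast_zmod_surjective b
  rw [map_natCast, ZMod.natCast_eq_zero_iff] at hb
  obtain ⟨d, rfl⟩ := hb
  have : ((2 ^ (k + 2) : ℕ) : ZMod (2 ^ (k + 2))) = 0 := ZMod.natCast_self _
  push_cast at this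
  rw [incl_natCast]
  push_cast
  linear_combination c * d * this

variable {V : Type*} [AddCommGroup V]

local notation "𝔸" => ZMod (2 ^ (k + 2)) × V

/-- The action on the second factor of an automorphism of `C_{2 ^ (k + 2)} × V`. -/
def diag (e : 𝔸 ≃+ 𝔸) : V →+ V :=
  (AddMonoidHom.snd _ _).comp (e.toAddMonoidHom.comp (AddMonoidHom.inr _ _))

/-- The component `V → C_{2 ^ (k + 2)}` of an automorphism of `C_{2 ^ (k + 2)} × V`. -/
def corner (e : 𝔸 ≃+ 𝔸) : V →+ ZMod (2 ^ (k + 2)) :=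
  (AddMonoidHom.fst _ _).comp (e.toAddMonoidHom.comp (AddMonoidHom.inr _ _))

/-- The scalar by which an automorphism of `C_{2 ^ (k + 2)} × V` acts on the quotient by
its elements of order two. -/
def scalar (e : 𝔸 ≃+ 𝔸) : ZMod (2 ^ (k + 1)) := red k (e (1, 0)).1

lemma map_zero_mk (e : 𝔸 ≃+ 𝔸) (v : V) : e (0, v) = (corner e v, diag e v) := rfl

lemma diag_refl (v : V) : diag (AddEquiv.refl 𝔸) v = v := rfl

variable [Module (ZMod 2) V]

lemma parity_smul_natCast (c : ℕ) (w : V) :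
    parity k (c : ZMod (2 ^ (k + 2))) • w = c • w := by
  rw [map_natCast, Nat.cast_smul_eq_nsmul]

lemma map_mk (e : 𝔸 →+ 𝔸) (x : ZMod (2 ^ (k + 2))) (v : V) :
    e (x, v) = (x * (e (1, 0)).1, parity k x • (e (1, 0)).2) + e (0, v) := by
  obtain ⟨c, rfl⟩ := ZMod.natCast_zmod_surjective x
  have : ((c : ZMod (2 ^ (k + 2))), v) = c • ((1 : ZMod (2 ^ (k + 2))), (0 : V)) + (0, v) := by
    simp
  rw [this, map_add, map_nsmul, parity_smul_natCast]
  congr 1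
  ext <;> simp

lemma red_apply_eq_zero (f : V →+ ZMod (2 ^ (k + 2))) (v : V) : red k (f v) = 0 := by
  apply red_eq_zero_of_two_mul
  rw [two_mul, ← map_add, ← two_smul (ZMod 2) v, show (2 : ZMod 2) = 0 from rfl, zero_smul,
    map_zero]

lemma red_fst_map (e : 𝔸 ≃+ 𝔸) (a : 𝔸) : red k (e a).1 = scalar e * red k a.1 := by
  obtain ⟨x, v⟩ := a
  have := map_mk e.toAddMonoidHom x v
  simp only [AddEquiv.toAddMonoidHom_eq_coe, AddMonoidHom.coe_coe] at this
  rw [this, map_zero_mk, Prod.fst_add, map_add, map_mul, red_apply_eq_zero, add_zero, mul_comm,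
    scalar]

lemma scalar_trans (e e' : 𝔸 ≃+ 𝔸) : scalar (e'.trans e) = scalar e * scalar e' := by
  rw [scalar, AddEquiv.trans_apply, red_fst_map]; rfl

lemma scalar_mul_scalar_symm (e : 𝔸 ≃+ 𝔸) : scalar e * scalar e.symm = 1 := by
  rw [← scalar_trans, AddEquiv.symm_trans_self]
  simp [scalar]

lemma map_mk_zero (e : 𝔸 ≃+ 𝔸) {y : ZMod (2 ^ (k + 2))} (hy : red k y = 0) :
    e (y, 0) = (y, 0) := by
  have := map_mk e.toAddMonoidHom y 0
  simp only [AddEquiv.toAddMonoidHom_eq_coe, AddMonoidHom.coe_coe, Prod.mk_zero_zero, map_zero,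
    add_zero] at this
  have odd : parity k (e (1, 0)).1 = 1 := by
    have h := congrArg (ZMod.castHom (dvd_pow_self 2 (Nat.succ_ne_zero k)) (ZMod 2))
      (scalar_mul_scalar_symm e)
    rw [map_mul, map_one] at h
    rw [parity_eq_cast_red]
    exact (by decide : ∀ a b : ZMod 2, a * b = 1 → a = 1) _ _ h
  have h1 : y * ((e (1, 0)).1 - 1) = 0 :=
    mul_eq_zero_of_red_of_parity hy (by rw [map_sub, odd, map_one, sub_self])
  rw [this, parity_eq_cast_red, hy, map_zero, zero_smul]
  ext
  · linear_combination h1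
  · rfl

lemma map_corner_diag (e e' : 𝔸 ≃+ 𝔸) (v : V) :
    e (e' (0, v)) = (corner e' v + corner e (diag e' v), diag e (diag e' v)) := by
  have : e' (0, v) = (corner e' v, 0) + (0, diag e' v) := by simp [map_zero_mk]
  rw [this, map_add, map_mk_zero e (red_apply_eq_zero _ _), map_zero_mk]
  simp

lemma corner_trans (e e' : 𝔸 ≃+ 𝔸) (v : V) :
    corner (e'.trans e) v = corner e' v + corner e (diag e' v) :=
  (Prod.ext_iff.1 (map_corner_diag _ _ v)).1

lemma diag_trans (e e' : 𝔸 ≃+ 𝔸) (v : V) : diag (e'.trans e) v = diag e (diag e' v) :=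

  (Prod.ext_iff.1 (map_corner_diag _ _ v)).2

/-- `diag` as an automorphism. -/
def diagEquiv (e : 𝔸 ≃+ 𝔸) : V ≃+ V where
  __ := diag e
  invFun := diag e.symm
  left_inv v := by
    change diag e.symm (diag e v) = v
    rw [← diag_trans, AddEquiv.self_trans_symm, diag_refl]
  right_inv v := by
    change diag e (diag e.symm v) = v
    rw [← diag_trans, AddEquiv.symm_trans_self, diag_refl]

/-- Multiplication by `scalar`, as an automorphism. -/
def scalarEquiv (e : 𝔸 ≃+ 𝔸) : ZMod (2 ^ (k + 1)) ≃+ ZMod (2 ^ (k + 1)) where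
  __ := AddMonoidHom.mulLeft (scalar e)
  invFun := AddMonoidHom.mulLeft (scalar e.symm)
  left_inv y := by
    have := scalar_mul_scalar_symm e
    change scalar e.symm * (scalar e * y) = y
    linear_combination y * this
  right_inv y := by
    have := scalar_mul_scalar_symm e
    change scalar e * (scalar e.symm * y) = y
    linear_combination y * this

/-- The contragredient action on `V →+ B`. -/
def precomp (B : Type*) [AddCommGroup B] (d : V ≃+ V) : (V →+ B) ≃+ (V →+ B) where
  toFun f := f.comp d.symm.toAddMonoidHom
  invFun f := f.comp d.toAddMonoidHom
  left_inv f := by ext; simp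
  right_inv f := by ext; simp
  map_add' _ _ := rfl

variable (k V) in
/-- The homomorphism from the holomorph of `C_{2 ^ (k + 2)} × V`, whose kernel is
elementary abelian. -/
def holHom : Hol (Multiplicative 𝔸) →* Hol (Multiplicative (V →+ ZMod (2 ^ (k + 2)))) ×
      Hol (Multiplicative (ZMod (2 ^ (k + 1)))) :=
  Hol.lift (fun a e ↦ (Hol.affine (corner e.symm) (precomp _ (diagEquiv e)),
      Hol.affine (red k a.1) (scalarEquiv e))) fun a e a' e' ↦ by
    rw [Prod.mk_mul_mk, Hol.affine_mul, Hol.affine_mul, Prod.mk.injEq, Hol.affine_inj,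
      Hol.affine_inj]
    refine ⟨⟨?_, fun f ↦ ?_⟩, ?_, fun y ↦ ?_⟩
    · ext v
      exact corner_trans e'.symm e.symm v
    · ext v
      exact congrArg f (diag_trans e'.symm e.symm v)
    · rw [Prod.fst_add, map_add, red_fst_map]
      rfl
    · change scalar _ * y = scalar e * (scalar e' * y)
      rw [scalar_trans, mul_assoc]

/-- The automorphism `(x, v) ↦ (a x + β v, d v)` of `C_{2 ^ (k + 2)} × V`. -/
def upper (a : (ZMod (2 ^ (k + 2)))ˣ) (β : V →+ ZMod (2 ^ (k + 2))) (d : V ≃+ V) : 𝔸 ≃+ 𝔸 where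
  toFun x := (a * x.1 + β x.2, d x.2)
  invFun x := (↑a⁻¹ * (x.1 - β (d.symm x.2)), d.symm x.2)
  left_inv x := by simp
  right_inv x := by simp
  map_add' x y := by ext <;> simp; ring

lemma addEquiv_eq_mul {r : ℕ} (h : ZMod r ≃+ ZMod r) (y : ZMod r) : h y = h 1 * y := by
  obtain ⟨c, rfl⟩ := ZMod.intCast_surjective y
  have := map_zsmul h c 1
  simpa [mul_comm] using this

lemma holHom_surjective
    (hV : Function.Surjective (precomp (ZMod (2 ^ (k + 2))) : (V ≃+ V) → _)) :
    Function.Surjective (holHom k V) := by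
  rintro ⟨s, t⟩
  obtain ⟨β, D, rfl⟩ := Hol.exists_affine s
  obtain ⟨y, h, rfl⟩ := Hol.exists_affine t
  obtain ⟨d, rfl⟩ := hV D
  obtain ⟨x, rfl⟩ := red_surjective y
  have hu : h 1 * h.symm 1 = 1 := by rw [← addEquiv_eq_mul, AddEquiv.apply_symm_apply]
  obtain ⟨a, ha⟩ := ZMod.unitsMap_surjective (pow_dvd_pow 2 (Nat.le_succ (k + 1)))
    (⟨h 1, h.symm 1, hu, by rw [mul_comm, hu]⟩ : (ZMod (2 ^ (k + 1)))ˣ)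
  have ha : red k a = h 1 := congrArg Units.val ha
  refine ⟨Hol.affine (x, 0) (upper a⁻¹ β d.symm).symm, ?_⟩
  rw [holHom, Hol.lift_affine, Prod.mk.injEq, Hol.affine_inj, Hol.affine_inj]
  refine ⟨⟨?_, fun f ↦ ?_⟩, rfl, fun y ↦ ?_⟩
  · ext v
    change (a⁻¹ : (ZMod (2 ^ (k + 2)))ˣ) * (0 : ZMod (2 ^ (k + 2))) + β v = β v
    rw [mul_zero, zero_add]
  · rfl
  · rw [addEquiv_eq_mul, addEquiv_eq_mul h, ← ha]
    congr 1
    change red k (_ * (1 - β _)) * 1 = _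
    simp

lemma incl_add_self (t : ZMod 2) : incl k t + incl k t = 0 := by
  rw [← map_add, CharTwo.add_self_eq_zero, map_zero]

lemma incl_mul_incl (s t : ZMod 2) : incl k s * incl k t = 0 :=
  mul_eq_zero_of_red_of_parity (red_incl s) (parity_incl t)

/-- The automorphism `(x, w) ↦ (x + incl t * x, w + x • c)` of `C_{2 ^ (k + 2)} × V`. -/
def lower (t : ZMod 2) (c : V) : 𝔸 ≃+ 𝔸 :=
  have inv : Function.Involutive fun x : 𝔸 ↦ (x.1 + incl k t * x.1, x.2 + parity k x.1 • c) := by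
    rintro ⟨x, w⟩
    have h := incl_add_self (k := k) t
    have h' := incl_mul_incl (k := k) t t
    ext1
    · change x + incl k t * x + incl k t * (x + incl k t * x) = x
      linear_combination x * h + x * h'
    · change w + parity k x • c + parity k (x + incl k t * x) • c = w
      rw [map_add, map_mul, parity_incl, zero_mul, add_zero, add_assoc, ← add_smul,
        CharTwo.add_self_eq_zero, zero_smul, add_zero]
  { toFun x := (x.1 + incl k t * x.1, x.2 + parity k x.1 • c)
    invFun x := (x.1 + incl k t * x.1, x.2 + parity k x.1 • c)
    left_inv := inv
    right_inv := inv
    map_add' x y := by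
      ext1
      · simp only [Prod.fst_add]; ring
      · simp only [Prod.fst_add, Prod.snd_add, map_add, add_smul]; abel }

lemma lower_apply (t : ZMod 2) (c : V) (x : 𝔸) :
    lower t c x = (x.1 + incl k t * x.1, x.2 + parity k x.1 • c) := rfl

variable (k V) in
/-- The kernel of `holHom`, as the image of an elementary abelian group. -/
def kerHom : Multiplicative ((ZMod 2 × V) × (ZMod 2 × V)) →* Hol (Multiplicative 𝔸) :=
  MonoidHom.mk' (fun p ↦ Hol.affine (incl k p.toAdd.1.1, p.toAdd.1.2)
      (lower p.toAdd.2.1 p.toAdd.2.2)) fun p q ↦ by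
    rw [Hol.affine_mul, Hol.affine_inj]
    constructor
    · simp [lower_apply, incl_mul_incl, parity_incl]
    · intro x
      simp only [AddEquiv.trans_apply, lower_apply, toAdd_mul, Prod.snd_add, Prod.fst_add, map_add,
        map_mul, parity_incl, zero_mul, add_zero, smul_add]
      ext1
      · have h := incl_mul_incl (k := k) p.toAdd.2.1 q.toAdd.2.1
        linear_combination -x.1 * h
      · change _ + (_ + _) = _ + _ + _
        abel

lemma kerHom_apply (p : Multiplicative ((ZMod 2 × V) × (ZMod 2 × V))) :
    kerHom k V p = Hol.affine (incl k p.toAdd.1.1, p.toAdd.1.2)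
      (lower p.toAdd.2.1 p.toAdd.2.2) := rfl

lemma kerHom_injective : Function.Injective (kerHom k V) := by
  intro p q h
  rw [kerHom_apply, kerHom_apply, Hol.affine_inj] at h
  obtain ⟨h1, h2⟩ := h
  have h3 := h2 (1, 0)
  simp only [lower_apply, Prod.mk.injEq, mul_one, map_one, one_smul, zero_add,
    add_right_inj] at h1 h3
  exact Multiplicative.toAdd.injective (Prod.ext (Prod.ext (incl_injective h1.1) h1.2)
    (Prod.ext (incl_injective h3.1) h3.2))

lemma holHom_affine (a : 𝔸) (e : 𝔸 ≃+ 𝔸) :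
    holHom k V (Hol.affine a e) = (Hol.affine (corner e.symm) (precomp _ (diagEquiv e)),
      Hol.affine (red k a.1) (scalarEquiv e)) := rfl

lemma holHom_affine_eq_one_iff
    (hV : Function.Injective (precomp (ZMod (2 ^ (k + 2))) : (V ≃+ V) → _))
    (a : 𝔸) (e : 𝔸 ≃+ 𝔸) :
    holHom k V (Hol.affine a e) = 1 ↔
      red k a.1 = 0 ∧ red k (e (1, 0)).1 = 1 ∧ ∀ v, e (0, v) = (0, v) := by
  rw [holHom_affine, Prod.mk_eq_one, ← Hol.affine_zero_refl, ← Hol.affine_zero_refl,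
    Hol.affine_inj, Hol.affine_inj]
  constructor
  · rintro ⟨⟨h1, h2⟩, h3, h4⟩
    have h5 : diagEquiv e = AddEquiv.refl V := hV (AddEquiv.ext h2)
    refine ⟨h3, (mul_one (scalar e)).symm.trans (h4 1), fun v ↦ ?_⟩
    rw [← AddEquiv.eq_symm_apply, map_zero_mk, h1]
    ext1
    · rfl
    · exact (congrArg (fun d ↦ d.symm v) h5).symm
  · rintro ⟨h1, h2, h3⟩
    have h4 (v : V) : e.symm (0, v) = (0, v) := by rw [AddEquiv.symm_apply_eq, h3]
    refine ⟨⟨?_, fun f ↦ ?_⟩, h1, fun y ↦ ?_⟩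
    · ext v
      exact congrArg Prod.fst (h4 v)
    · ext v
      exact congrArg (fun x ↦ f x.2) (h4 v)
    · change red k (e (1, 0)).1 * y = y
      rw [h2, one_mul]

lemma range_kerHom (hV : Function.Injective (precomp (ZMod (2 ^ (k + 2))) : (V ≃+ V) → _)) :
    (kerHom k V).range = (holHom k V).ker := by
  ext t
  obtain ⟨a, e, rfl⟩ := Hol.exists_affine t
  rw [MonoidHom.mem_ker, holHom_affine_eq_one_iff hV]
  constructor
  · rintro ⟨p, hp⟩
    rw [kerHom_apply, Hol.affine_inj] at hp
    obtain ⟨rfl, h⟩ := hp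
    simp [← h, lower_apply, red_incl]
  · rintro ⟨h1, h2, h3⟩
    obtain ⟨s, hs⟩ := exists_incl_of_red_eq_zero h1
    obtain ⟨t, ht⟩ := exists_incl_of_red_eq_zero (y := (e (1, 0)).1 - 1)
      (by rw [map_sub, h2, map_one, sub_self])
    refine ⟨Multiplicative.ofAdd ((s, a.2), (t, (e (1, 0)).2)), ?_⟩
    rw [kerHom_apply, Hol.affine_inj]
    refine ⟨Prod.ext hs rfl, fun x ↦ ?_⟩
    have := map_mk e.toAddMonoidHom x.1 x.2
    simp only [AddEquiv.toAddMonoidHom_eq_coe, AddMonoidHom.coe_coe, Prod.mk.eta] at this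
    rw [this, h3, lower_apply]
    ext1
    · simp only [toAdd_ofAdd, ht, Prod.fst_add]; ring
    · exact add_comm _ _

variable {n : ℕ}

variable (k n) in
/-- The self-duality of an elementary abelian `2`-group given by the dot product. -/
noncomputable def dotEquiv : (Fin n → ZMod 2) ≃+ ((Fin n → ZMod 2) →+ ZMod (2 ^ (k + 2))) :=
  AddEquiv.ofBijective (AddMonoidHom.mk' (fun u ↦ (incl k).comp
      (AddMonoidHom.mk' (fun v ↦ u ⬝ᵥ v) (dotProduct_add u)))
      fun u u' ↦ by ext v; simp [add_dotProduct]) <| by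
    constructor
    · intro u u' h
      exact dotProduct_eq _ _ fun v ↦ incl_injective (DFunLike.congr_fun h v)
    · intro f
      choose g hg using fun v ↦ exists_incl_of_red_eq_zero (red_apply_eq_zero f v)
      refine ⟨fun i ↦ g (Pi.single i 1), ?_⟩
      ext i c
      obtain ⟨c, rfl⟩ := ZMod.natCast_zmod_surjective c
      have hc : Pi.single i (c : ZMod 2) = c • (Pi.single i 1 : Fin n → ZMod 2) := by
        rw [← Pi.single_smul]; simp
      simp only [AddMonoidHom.comp_apply, AddMonoidHom.single_apply, hc, map_nsmul]
      simp [hg]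

lemma precomp_injective :
    Function.Injective (precomp (V := Fin n → ZMod 2) (ZMod (2 ^ (k + 2)))) := by
  intro d d' h
  have key : d.symm = d'.symm := by
    ext v : 1
    refine dotProduct_eq _ _ fun u ↦ ?_
    have := DFunLike.congr_fun (DFunLike.congr_fun h (dotEquiv k n u)) v
    rw [dotProduct_comm, dotProduct_comm _ u]
    exact incl_injective this
  rw [← d.symm_symm, key, d'.symm_symm]

lemma precomp_bijective :
    Function.Bijective (precomp (V := Fin n → ZMod 2) (ZMod (2 ^ (k + 2)))) := by
  have := Finite.of_equiv _ (dotEquiv k n).toEquiv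
  have := DFunLike.finite
    (((Fin n → ZMod 2) →+ ZMod (2 ^ (k + 2))) ≃+ ((Fin n → ZMod 2) →+ ZMod (2 ^ (k + 2))))
  exact precomp_injective.bijective_of_nat_card_le
    (Nat.card_congr (AddAut.congr (dotEquiv k n).symm).toEquiv).le

end TwoPow

/-- For `m ≥ 2` and `n ≥ 1`, the holomorph `Hol(C_{2^m} × (C_2)^n)` has a normal subgroup
`N` isomorphic to the elementary abelian group `(C_2)^(2(n+1))` such that the quotient is
isomorphic to `Hol((C_2)^n) × Hol(C_{2^(m-1)})`. -/
theorem hol_zmod_two_pow_mul_elementary_structure (m n : ℕ) (hm : 2 ≤ m) (hn : 1 ≤ n) :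
    ∃ (N : Subgroup (Hol (Multiplicative (ZMod (2 ^ m) × (Fin n → ZMod 2))))) (hN : N.Normal),
      Nonempty (N ≃* Multiplicative (Fin (2 * (n + 1)) → ZMod 2)) ∧
      Nonempty (letI := hN;
        (Hol (Multiplicative (ZMod (2 ^ m) × (Fin n → ZMod 2))) ⧸ N) ≃*
          Hol (Multiplicative (Fin n → ZMod 2)) × Hol (Multiplicative (ZMod (2 ^ (m - 1))))) := by
  obtain ⟨k, rfl⟩ := Nat.exists_eq_add_of_le' hm
  refine ⟨(TwoPow.holHom k (Fin n → ZMod 2)).ker, MonoidHom.normal_ker _, ⟨?_⟩, ⟨?_⟩⟩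
  · refine (MulEquiv.subgroupCongr (TwoPow.range_kerHom TwoPow.precomp_injective)).symm.trans
      ((MonoidHom.ofInjective TwoPow.kerHom_injective).symm.trans (AddEquiv.toMultiplicative ?_))
    refine (LinearEquiv.ofFinrankEq (R := ZMod 2) _ _ ?_).toAddEquiv
    simp
    ring
  · exact (QuotientGroup.quotientKerEquivOfSurjective _
      (TwoPow.holHom_surjective TwoPow.precomp_bijective.2)).trans
      ((Hol.congr (TwoPow.dotEquiv k n).symm).prodCongr (MulEquiv.refl _))
end

section
/- In GL(4, F_2), the subgroup generated by the four matrices t1 = [[1,0,0,0],[0,1,0,0],[0,0,1,0],[1,0,0,1]], t2 = [[1,0,0,0],[0,1,0,0],[0,0,1,0],[0,1,0,1]], t3 = [[1,0,0,0],[0,1,0,0],[0,0,0,1],[0,0,1,0]], t4 = [[1,0,0,0],[0,0,1,0],[0,1,0,0],[0,0,0,1]] is isomorphic to the holomorph Hol((C_2)^3) of the elementary abelian group of order 8. -/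
def t1 : Matrix (Fin 4) (Fin 4) (ZMod 2) := !![1,0,0,0; 0,1,0,0; 0,0,1,0; 1,0,0,1]
def t2 : Matrix (Fin 4) (Fin 4) (ZMod 2) := !![1,0,0,0; 0,1,0,0; 0,0,1,0; 0,1,0,1]
def t3 : Matrix (Fin 4) (Fin 4) (ZMod 2) := !![1,0,0,0; 0,1,0,0; 0,0,0,1; 0,0,1,0]
def t4 : Matrix (Fin 4) (Fin 4) (ZMod 2) := !![1,0,0,0; 0,0,1,0; 0,1,0,0; 0,0,0,1]

def g1 : Matrix.GeneralLinearGroup (Fin 4) (ZMod 2) := ⟨t1, t1, by decide, by decide⟩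
def g2 : Matrix.GeneralLinearGroup (Fin 4) (ZMod 2) := ⟨t2, t2, by decide, by decide⟩
def g3 : Matrix.GeneralLinearGroup (Fin 4) (ZMod 2) := ⟨t3, t3, by decide, by decide⟩
def g4 : Matrix.GeneralLinearGroup (Fin 4) (ZMod 2) := ⟨t4, t4, by decide, by decide⟩

open Matrix

/-- The block matrix `[1 0; v A]`, which acts on column vectors `(1, x)` as the affine map
`x ↦ v + A x`. -/
def affineMatrix {n : ℕ} {R : Type*} [Zero R] [One R] (v : Fin n → R)
    (A : Matrix (Fin n) (Fin n) R) : Matrix (Fin (n + 1)) (Fin (n + 1)) R :=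
  Matrix.of (Fin.cons (Fin.cons 1 0) fun i => Fin.cons (v i) (A i))

section AffineMatrix

variable {n : ℕ} {R : Type*}

theorem affineMatrix_mul [CommSemiring R] (v w : Fin n → R) (A B : Matrix (Fin n) (Fin n) R) :
    affineMatrix v A * affineMatrix w B = affineMatrix (v + A *ᵥ w) (A * B) := by
  ext i j
  refine Fin.cases ?_ (fun i => ?_) i <;> refine Fin.cases ?_ (fun j => ?_) j <;>
    simp [affineMatrix, Matrix.mul_apply, Fin.sum_univ_succ, Matrix.mulVec, dotProduct]

theorem affineMatrix_zero_one [CommSemiring R] :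
    affineMatrix (0 : Fin n → R) 1 = 1 := by
  ext i j
  refine Fin.cases ?_ (fun i => ?_) i <;> refine Fin.cases ?_ (fun j => ?_) j <;>
    simp [affineMatrix, Matrix.one_apply, Fin.ext_iff]

theorem affineMatrix_injective [Zero R] [One R] {v w : Fin n → R}
    {A B : Matrix (Fin n) (Fin n) R} (h : affineMatrix v A = affineMatrix w B) :
    v = w ∧ A = B := by
  refine ⟨funext fun i => ?_, Matrix.ext fun i j => ?_⟩
  · simpa [affineMatrix] using congrFun (congrFun h i.succ) 0
  · simpa [affineMatrix] using congrFun (congrFun h i.succ) j.succ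

end AffineMatrix

section AutMatrix

variable {n p : ℕ}

/-- The `ZMod p`-linear endomorphism underlying an automorphism of `(C_p)^n`. -/
def autLinearMap (α : MulAut (Multiplicative (Fin n → ZMod p))) :
    (Fin n → ZMod p) →ₗ[ZMod p] (Fin n → ZMod p) :=
  (AddEquiv.toMultiplicative.symm α).toAddMonoidHom.toZModLinearMap p

theorem autLinearMap_apply (α : MulAut (Multiplicative (Fin n → ZMod p))) (v : Fin n → ZMod p) :
    autLinearMap α v = (α (Multiplicative.ofAdd v)).toAdd := rfl

/-- The matrix of an automorphism of `(C_p)^n`. -/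
def autMatrix (α : MulAut (Multiplicative (Fin n → ZMod p))) : Matrix (Fin n) (Fin n) (ZMod p) :=
  LinearMap.toMatrix' (autLinearMap α)

theorem autMatrix_one : autMatrix (1 : MulAut (Multiplicative (Fin n → ZMod p))) = 1 :=
  LinearMap.toMatrix'_one

theorem autMatrix_mul (α β : MulAut (Multiplicative (Fin n → ZMod p))) :
    autMatrix (α * β) = autMatrix α * autMatrix β :=
  LinearMap.toMatrix'_mul (autLinearMap α) (autLinearMap β)

theorem autMatrix_mulVec (α : MulAut (Multiplicative (Fin n → ZMod p))) (v : Fin n → ZMod p) :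
    autMatrix α *ᵥ v = (α (Multiplicative.ofAdd v)).toAdd :=
  LinearMap.toMatrix'_mulVec _ _

theorem autMatrix_injective :
    Function.Injective (autMatrix : MulAut (Multiplicative (Fin n → ZMod p)) → _) := by
  intro α β h
  ext1 x
  have := congrArg (· *ᵥ x.toAdd) h
  simpa only [autMatrix_mulVec, ofAdd_toAdd, EmbeddingLike.apply_eq_iff_eq] using this

theorem exists_autMatrix_eq {A B : Matrix (Fin n) (Fin n) (ZMod p)} (hAB : A * B = 1)
    (hBA : B * A = 1) : ∃ α, autMatrix α = A := by
  refine ⟨AddEquiv.toMultiplicative (Matrix.toLin'OfInv hBA hAB).toAddEquiv, ?_⟩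
  refine (LinearEquiv.eq_symm_apply LinearMap.toMatrix').mp ?_
  ext1 i
  rfl

theorem autMatrix_det_ne_zero [Fact p.Prime] (α : MulAut (Multiplicative (Fin n → ZMod p))) :
    (autMatrix α).det ≠ 0 := by
  refine left_ne_zero_of_mul_eq_one (b := (autMatrix α⁻¹).det) ?_
  rw [← Matrix.det_mul, ← autMatrix_mul, mul_inv_cancel, autMatrix_one, Matrix.det_one]

/-- The affine representation of the holomorph of `(C_p)^n` by matrices of size `n + 1`. -/
def holToGL (n p : ℕ) :
    Hol (Multiplicative (Fin n → ZMod p)) →*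
      Matrix.GeneralLinearGroup (Fin (n + 1)) (ZMod p) :=
  MonoidHom.toHomUnits
    { toFun := fun x => affineMatrix x.left.toAdd (autMatrix x.right)
      map_one' := (congrArg (affineMatrix 0) autMatrix_one).trans affineMatrix_zero_one
      map_mul' := fun x y => by
        rw [affineMatrix_mul, ← autMatrix_mul, autMatrix_mulVec]
        rfl }

theorem coe_holToGL (x : Hol (Multiplicative (Fin n → ZMod p))) :
    (holToGL n p x : Matrix (Fin (n + 1)) (Fin (n + 1)) (ZMod p)) =
      affineMatrix x.left.toAdd (autMatrix x.right) := rfl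

theorem holToGL_injective : Function.Injective (holToGL n p) := by
  intro x y h
  obtain ⟨hl, hr⟩ := affineMatrix_injective (congrArg Units.val h)
  exact SemidirectProduct.ext hl (autMatrix_injective hr)

theorem mem_range_holToGL {g : Matrix.GeneralLinearGroup (Fin (n + 1)) (ZMod p)}
    (v : Fin n → ZMod p) (A B : Matrix (Fin n) (Fin n) (ZMod p)) (hAB : A * B = 1)
    (hBA : B * A = 1) (hg : g.val = affineMatrix v A) : g ∈ (holToGL n p).range := by
  obtain ⟨α, rfl⟩ := exists_autMatrix_eq hAB hBA
  exact ⟨⟨Multiplicative.ofAdd v, α⟩, Units.ext hg.symm⟩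

end AutMatrix

/-- The subgroup of `GL(4, F₂)` generated by `g1, g2, g3, g4`. -/
abbrev fourClosure : Subgroup (Matrix.GeneralLinearGroup (Fin 4) (ZMod 2)) :=
  Subgroup.closure {g1, g2, g3, g4}

theorem g1_mem_fourClosure : g1 ∈ fourClosure := Subgroup.subset_closure (by simp)

theorem g2_mem_fourClosure : g2 ∈ fourClosure := Subgroup.subset_closure (by simp)

theorem g3_mem_fourClosure : g3 ∈ fourClosure := Subgroup.subset_closure (by simp)

theorem g4_mem_fourClosure : g4 ∈ fourClosure := Subgroup.subset_closure (by simp)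

theorem conj_g3_mem_fourClosure {g : Matrix.GeneralLinearGroup (Fin 4) (ZMod 2)}
    (hg : g ∈ fourClosure) : g3 * g * g3 ∈ fourClosure :=
  mul_mem (mul_mem g3_mem_fourClosure hg) g3_mem_fourClosure

theorem conj_g4_mem_fourClosure {g : Matrix.GeneralLinearGroup (Fin 4) (ZMod 2)}
    (hg : g ∈ fourClosure) : g4 * g * g4 ∈ fourClosure :=
  mul_mem (mul_mem g4_mem_fourClosure hg) g4_mem_fourClosure

theorem fourClosure_le_range : fourClosure ≤ (holToGL 3 2).range := by
  rw [Subgroup.closure_le]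
  rintro g (rfl | rfl | rfl | rfl)
  · exact mem_range_holToGL ![0, 0, 1] 1 1 (by decide) (by decide) (by decide)
  · exact mem_range_holToGL 0 !![1,0,0; 0,1,0; 1,0,1] !![1,0,0; 0,1,0; 1,0,1]
      (by decide) (by decide) (by decide)
  · exact mem_range_holToGL 0 !![1,0,0; 0,0,1; 0,1,0] !![1,0,0; 0,0,1; 0,1,0]
      (by decide) (by decide) (by decide)
  · exact mem_range_holToGL 0 !![0,1,0; 1,0,0; 0,0,1] !![0,1,0; 1,0,0; 0,0,1]
      (by decide) (by decide) (by decide)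

theorem exists_mem_fourClosure_translation (v : Fin 3 → ZMod 2) :
    ∃ g ∈ fourClosure, g.val = affineMatrix v 1 := by
  have key : ∀ i : Fin 3, ∀ c : ZMod 2,
      ∃ g ∈ fourClosure, g.val = affineMatrix (Pi.single i c) 1 := by
    intro i c
    have h2 := g1_mem_fourClosure
    have h1 := conj_g3_mem_fourClosure h2
    have h0 := conj_g4_mem_fourClosure h1
    obtain rfl | rfl : c = 0 ∨ c = 1 := by revert c; decide
    · exact ⟨1, one_mem _, by rw [Pi.single_zero, affineMatrix_zero_one, Units.val_one]⟩
    · fin_cases i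
      · exact ⟨_, h0, by decide⟩
      · exact ⟨_, h1, by decide⟩
      · exact ⟨_, h2, by decide⟩
  induction v using Pi.single_induction with
  | zero => exact ⟨1, one_mem _, by rw [affineMatrix_zero_one, Units.val_one]⟩
  | add v w hv hw =>
    obtain ⟨g, hg, hgv⟩ := hv
    obtain ⟨k, hk, hkw⟩ := hw
    exact ⟨g * k, mul_mem hg hk, by
      rw [Units.val_mul, hgv, hkw, affineMatrix_mul, Matrix.one_mulVec, mul_one]⟩
  | single i c => exact key i c

theorem exists_mem_fourClosure_transvection {i j : Fin 3} (hij : i ≠ j) (c : ZMod 2) :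
    ∃ g ∈ fourClosure, g.val = affineMatrix 0 (Matrix.transvection i j c) := by
  obtain rfl | rfl : c = 0 ∨ c = 1 := by revert c; decide
  · exact ⟨1, one_mem _, by rw [Matrix.transvection_zero, affineMatrix_zero_one, Units.val_one]⟩
  · have h20 := g2_mem_fourClosure
    have h10 := conj_g3_mem_fourClosure h20
    have h21 := conj_g4_mem_fourClosure h20
    have h01 := conj_g4_mem_fourClosure h10
    have h12 := conj_g3_mem_fourClosure h21
    have h02 := conj_g4_mem_fourClosure h12
    fin_cases i <;> fin_cases j
    · exact absurd rfl hij
    · exact ⟨_, h01, by decide⟩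
    · exact ⟨_, h02, by decide⟩
    · exact ⟨_, h10, by decide⟩
    · exact absurd rfl hij
    · exact ⟨_, h12, by decide⟩
    · exact ⟨_, h20, by decide⟩
    · exact ⟨_, h21, by decide⟩
    · exact absurd rfl hij

theorem exists_mem_fourClosure_linear {A : Matrix (Fin 3) (Fin 3) (ZMod 2)} (hA : A.det ≠ 0) :
    ∃ g ∈ fourClosure, g.val = affineMatrix 0 A := by
  refine Matrix.diagonal_transvection_induction_of_det_ne_zero
    (fun A => ∃ g ∈ fourClosure, g.val = affineMatrix 0 A) A hA ?_ ?_ ?_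
  · intro D hD
    rw [Matrix.det_diagonal, Finset.prod_ne_zero_iff] at hD
    have h_one : D = 1 := funext fun i => Fin.eq_one_of_ne_zero (D i) (hD i (Finset.mem_univ i))
    refine ⟨1, one_mem _, ?_⟩
    rw [h_one, Matrix.diagonal_one', affineMatrix_zero_one, Units.val_one]
  · exact fun t => exists_mem_fourClosure_transvection t.hij t.c
  · rintro A B - - ⟨g, hg, hgA⟩ ⟨k, hk, hkB⟩
    exact ⟨g * k, mul_mem hg hk, by
      rw [Units.val_mul, hgA, hkB, affineMatrix_mul, Matrix.mulVec_zero, add_zero]⟩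

theorem range_le_fourClosure : (holToGL 3 2).range ≤ fourClosure := by
  rintro _ ⟨x, rfl⟩
  obtain ⟨g, hg, hgv⟩ := exists_mem_fourClosure_translation x.left.toAdd
  obtain ⟨k, hk, hkA⟩ := exists_mem_fourClosure_linear (autMatrix_det_ne_zero x.right)
  have h_eq : holToGL 3 2 x = g * k := Units.ext <| by
    rw [Units.val_mul, hgv, hkA, affineMatrix_mul, Matrix.mulVec_zero, add_zero, one_mul,
      coe_holToGL]
  exact h_eq ▸ mul_mem hg hk

/-- The subgroup of `GL(4, F₂)` generated by the four matrices `t1, t2, t3, t4` is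
isomorphic to the holomorph `Hol((C_2)^3)` of the elementary abelian group of order 8. -/
theorem closure_four_matrices_iso_hol :
    Nonempty ((Subgroup.closure {g1, g2, g3, g4} :
        Subgroup (Matrix.GeneralLinearGroup (Fin 4) (ZMod 2))) ≃*
      Hol (Multiplicative (Fin 3 → ZMod 2))) := by
  have h_range : fourClosure = (holToGL 3 2).range :=
    le_antisymm fourClosure_le_range range_le_fourClosure
  exact ⟨(MulEquiv.subgroupCongr h_range).trans (MonoidHom.ofInjective holToGL_injective).symm⟩
end
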